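/- arXiv:1102.4276 — 3 statements merged into one kernel-verified Lean document; each statement's English description precedes it below -/
import Mathlib

section
/- Let V ⊆ ℝ² be open, let z, z̄ : V → ℝ be differentiable and satisfy ∂₀z = ∂₁z̄ and ∂₁z = ∂₀z̄ on V, and let ψ, φ be differentiable functions of (z, z̄) on an open set containing the image of (z, z̄), satisfying μ(z̄)∂_zψ = ∂_z̄φ and μ(z̄)∂_z̄ψ = ∂_zφ there, where μ is a positive function. Then the map Ψ̄(x̄) = (ψ(z(x̄), z̄(x̄)), φ(z(x̄), z̄(x̄))) is differentiable on V, its Jacobian matrix factors as J_Ψ̄ = [[∂_z̄φ/μ, ∂_zφ/μ],[∂_zφ, ∂_z̄φ]] · [[∂₁z̄, ∂₀z̄],[∂₀z̄, ∂₁z̄]] (all entries evaluated at (z(x̄), z̄(x̄)) and x̄ respectively), and its Jacobian determinant equals μ(z̄) · ((∂_z̄φ/μ)² − (∂_zφ/μ)²) · ((∂₁z̄)² − (∂₀z̄)²). -/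
open Real Matrix

theorem aux_partials (f : ℝ → ℝ → ℝ) (a b : ℝ)
    (hf : DifferentiableAt ℝ (fun p : ℝ × ℝ => f p.1 p.2) (a, b)) :
    HasDerivAt (fun t => f t b) (fderiv ℝ (fun p : ℝ × ℝ => f p.1 p.2) (a, b) (1, 0)) a ∧
    HasDerivAt (fun s => f a s) (fderiv ℝ (fun p : ℝ × ℝ => f p.1 p.2) (a, b) (0, 1)) b := by
  constructor
  · exact hf.hasFDerivAt.comp_hasDerivAt (f := fun t : ℝ => (t, b)) a
      ((hasDerivAt_id a).prodMk (hasDerivAt_const a b))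
  · exact hf.hasFDerivAt.comp_hasDerivAt (f := fun s : ℝ => (a, s)) b
      ((hasDerivAt_const b a).prodMk (hasDerivAt_id b))

theorem aux_chain (f : ℝ → ℝ → ℝ) (u v : ℝ → ℝ) (t : ℝ)
    (hf : DifferentiableAt ℝ (fun p : ℝ × ℝ => f p.1 p.2) (u t, v t))
    (hu : DifferentiableAt ℝ u t) (hv : DifferentiableAt ℝ v t) :
    deriv (fun r => f (u r) (v r)) t
      = deriv (fun r => f r (v t)) (u t) * deriv u t
        + deriv (fun r => f (u t) r) (v t) * deriv v t := by
  obtain ⟨h1, h2⟩ := aux_partials f _ _ hf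
  have h := hf.hasFDerivAt.comp_hasDerivAt (f := fun r : ℝ => (u r, v r)) t
    (hu.hasDerivAt.prodMk hv.hasDerivAt)
  have h' : deriv (fun r => f (u r) (v r)) t = _ := h.deriv
  rw [h', h1.deriv, h2.deriv]
  have e : ((deriv u t, deriv v t) : ℝ × ℝ)
      = deriv u t • ((1, 0) : ℝ × ℝ) + deriv v t • ((0, 1) : ℝ × ℝ) := by simp
  rw [e, map_add, map_smul, map_smul, smul_eq_mul, smul_eq_mul]
  ring

/-- Factorization of the Jacobian of the change of coordinates
`Ψ̄(x̄) = (ψ(z(x̄), z̄(x̄)), φ(z(x̄), z̄(x̄)))` built from a wave-equation solution `z̄`, its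
conjugate potential `z` (satisfying `∂₀z = ∂₁z̄`, `∂₁z = ∂₀z̄`), and a solution `(ψ, φ)` of
the conformal gauge system `μ∂_zψ = ∂_z̄φ`, `μ∂_z̄ψ = ∂_zφ` with `μ` positive. -/
theorem jacobian_factorization (V W : Set (ℝ × ℝ)) (hV : IsOpen V) (hW : IsOpen W)
    (z zb ψ φ : ℝ → ℝ → ℝ) (μ : ℝ → ℝ) (hμ : ∀ ζ : ℝ, 0 < μ ζ)
    (hzdiff : ∀ x ∈ V, DifferentiableAt ℝ (fun p : ℝ × ℝ => z p.1 p.2) x)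
    (hzbdiff : ∀ x ∈ V, DifferentiableAt ℝ (fun p : ℝ × ℝ => zb p.1 p.2) x)
    (himg : ∀ x ∈ V, (z x.1 x.2, zb x.1 x.2) ∈ W)
    (hψdiff : ∀ w ∈ W, DifferentiableAt ℝ (fun p : ℝ × ℝ => ψ p.1 p.2) w)
    (hφdiff : ∀ w ∈ W, DifferentiableAt ℝ (fun p : ℝ × ℝ => φ p.1 p.2) w)
    (hconj0 : ∀ x ∈ V, deriv (fun t => z t x.2) x.1 = deriv (fun s => zb x.1 s) x.2)
    (hconj1 : ∀ x ∈ V, deriv (fun s => z x.1 s) x.2 = deriv (fun t => zb t x.2) x.1)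
    (hsys1 : ∀ w ∈ W, μ w.2 * deriv (fun t => ψ t w.2) w.1 = deriv (fun s => φ w.1 s) w.2)
    (hsys2 : ∀ w ∈ W, μ w.2 * deriv (fun s => ψ w.1 s) w.2 = deriv (fun t => φ t w.2) w.1) :
    ∀ x ∈ V,
      DifferentiableAt ℝ (fun p : ℝ × ℝ =>
        (ψ (z p.1 p.2) (zb p.1 p.2), φ (z p.1 p.2) (zb p.1 p.2))) x ∧
      (!![deriv (fun t => ψ (z t x.2) (zb t x.2)) x.1,
          deriv (fun s => ψ (z x.1 s) (zb x.1 s)) x.2;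
          deriv (fun t => φ (z t x.2) (zb t x.2)) x.1,
          deriv (fun s => φ (z x.1 s) (zb x.1 s)) x.2]
        = !![deriv (fun s => φ (z x.1 x.2) s) (zb x.1 x.2) / μ (zb x.1 x.2),
             deriv (fun t => φ t (zb x.1 x.2)) (z x.1 x.2) / μ (zb x.1 x.2);
             deriv (fun t => φ t (zb x.1 x.2)) (z x.1 x.2),
             deriv (fun s => φ (z x.1 x.2) s) (zb x.1 x.2)]
          * !![deriv (fun s => zb x.1 s) x.2, deriv (fun t => zb t x.2) x.1;
               deriv (fun t => zb t x.2) x.1, deriv (fun s => zb x.1 s) x.2]) ∧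
      (!![deriv (fun t => ψ (z t x.2) (zb t x.2)) x.1,
          deriv (fun s => ψ (z x.1 s) (zb x.1 s)) x.2;
          deriv (fun t => φ (z t x.2) (zb t x.2)) x.1,
          deriv (fun s => φ (z x.1 s) (zb x.1 s)) x.2]).det
        = μ (zb x.1 x.2)
          * ((deriv (fun s => φ (z x.1 x.2) s) (zb x.1 x.2) / μ (zb x.1 x.2)) ^ 2
            - (deriv (fun t => φ t (zb x.1 x.2)) (z x.1 x.2) / μ (zb x.1 x.2)) ^ 2)
          * ((deriv (fun s => zb x.1 s) x.2) ^ 2 - (deriv (fun t => zb t x.2) x.1) ^ 2) := by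
  intro x hx
  have hw := himg x hx
  have hz := hzdiff x hx
  have hzb := hzbdiff x hx
  have hψ := hψdiff _ hw
  have hφ := hφdiff _ hw
  have c0 := hconj0 x hx
  have c1 := hconj1 x hx
  have s1 := hsys1 _ hw
  have s2 := hsys2 _ hw
  have hm : μ (zb x.1 x.2) ≠ 0 := (hμ _).ne'
  obtain ⟨z0, z1⟩ := aux_partials z x.1 x.2 hz
  obtain ⟨zb0, zb1⟩ := aux_partials zb x.1 x.2 hzb
  have eψ0 := aux_chain ψ (fun t => z t x.2) (fun t => zb t x.2) x.1 hψ
    z0.differentiableAt zb0.differentiableAt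
  have eψ1 := aux_chain ψ (fun s => z x.1 s) (fun s => zb x.1 s) x.2 hψ
    z1.differentiableAt zb1.differentiableAt
  have eφ0 := aux_chain φ (fun t => z t x.2) (fun t => zb t x.2) x.1 hφ
    z0.differentiableAt zb0.differentiableAt
  have eφ1 := aux_chain φ (fun s => z x.1 s) (fun s => zb x.1 s) x.2 hφ
    z1.differentiableAt zb1.differentiableAt
  have p1 := eq_div_of_mul_eq hm ((mul_comm _ _).trans s1)
  have p2 := eq_div_of_mul_eq hm ((mul_comm _ _).trans s2)
  dsimp only at eψ0 eψ1 eφ0 eφ1 p1 p2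
  rw [p1, p2, c0] at eψ0
  rw [p1, p2, c1] at eψ1
  rw [c0] at eφ0
  rw [c1] at eφ1
  refine ⟨?_, ?_, ?_⟩
  · have hpair := hz.prodMk hzb
    exact (DifferentiableAt.comp (f := fun p : ℝ × ℝ => (z p.1 p.2, zb p.1 p.2)) x hψ hpair).prodMk
      (DifferentiableAt.comp (f := fun p : ℝ × ℝ => (z p.1 p.2, zb p.1 p.2)) x hφ hpair)
  · rw [eψ0, eψ1, eφ0, eφ1, Matrix.mul_fin_two]
  · rw [eψ0, eψ1, eφ0, eφ1, Matrix.det_fin_two_of]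
    field_simp
    ring
end

section
/- Let c₁, c₂ ∈ ℝ and define φ(z, z̄) = (c₁ + c₂ z)·(1/12 − cos(z̄)/8 + cos³(z̄)/24) on ℝ × (0, π/2). Then φ satisfies the singular linear wave equation ∂_z²φ − μ(z̄) ∂_z̄( μ(z̄)^{-1} ∂_z̄ φ ) = 0 on ℝ × (0, π/2), where μ(ζ) = sin³(ζ)/8. -/
open Real

/-- The exact solution `φ(z,z̄) = (c₁ + c₂ z)(1/12 − cos(z̄)/8 + cos³(z̄)/24)` satisfies the
singular linear wave equation `∂_z²φ − μ(z̄)∂_z̄(μ(z̄)⁻¹ ∂_z̄φ) = 0` on `ℝ × (0, π/2)`,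
where `μ(ζ) = sin³(ζ)/8`. -/
theorem exact_solution_solves_wave (c1 c2 : ℝ) :
    ∀ z : ℝ, ∀ zb ∈ Set.Ioo (0:ℝ) (Real.pi / 2),
      deriv (fun t => deriv (fun t' =>
          (c1 + c2 * t') * (1/12 - Real.cos zb / 8 + Real.cos zb ^ 3 / 24)) t) z
        - (Real.sin zb ^ 3 / 8) * deriv (fun s => (Real.sin s ^ 3 / 8)⁻¹ *
            deriv (fun s' => (c1 + c2 * z) * (1/12 - Real.cos s' / 8 + Real.cos s' ^ 3 / 24)) s)
            zb = 0 := by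
  intro z zb hzb
  have h1 : ∀ k t : ℝ, deriv (fun t' : ℝ => (c1 + c2 * t') * k) t = c2 * k := by
    intro k t
    have h := (((hasDerivAt_id t).const_mul c2).const_add c1).mul_const k
    simpa using h.deriv
  have h2 : ∀ s : ℝ, deriv (fun s' => (c1 + c2 * z) *
      (1/12 - Real.cos s' / 8 + Real.cos s' ^ 3 / 24)) s
        = (c1 + c2 * z) * (Real.sin s ^ 3 / 8) := by
    intro s
    have hc := Real.hasDerivAt_cos s
    have h := ((((hc.div_const 8).const_sub (1/12)).add
      ((hc.pow 3).div_const 24)).const_mul (c1 + c2 * z))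
    refine h.deriv.trans ?_
    have e : Real.sin s ^ 3 = Real.sin s * (1 - Real.cos s ^ 2) := by
      rw [← Real.sin_sq]; ring
    rw [e]
    push_cast
    ring
  have hev : (fun s => (Real.sin s ^ 3 / 8)⁻¹ * ((c1 + c2 * z) * (Real.sin s ^ 3 / 8)))
      =ᶠ[nhds zb] fun _ => c1 + c2 * z := by
    have hmem : Set.Ioo (0:ℝ) (Real.pi / 2) ∈ nhds zb := isOpen_Ioo.mem_nhds hzb
    filter_upwards [hmem] with s hs
    have hpos : 0 < Real.sin s :=
      Real.sin_pos_of_pos_of_lt_pi hs.1 (by linarith [hs.2, Real.pi_pos])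
    field_simp
  simp only [h1, h2]
  rw [hev.deriv_eq]
  simp
end

section
/- Let μ(x) = sin³(x)/8 on (0, π/2), ξ(x) = ∫₀^x μ(s) ds, ξ₀ = ξ(π/2), LΦ = μ^{-1/2}(√μ Φ)', and HΦ = −√μ (μ^{-1}(√μ Φ)')'. There exists a constant C > 0 such that for every smooth compactly supported Φ : (0, π/2) → ℝ, writing g : (0, ξ₀) → ℝ for the function determined by g(ξ(x)) = √(μ(x)) Φ(x), one has ∫₀^{ξ₀} ( ξ^{-3/2} g(ξ)² + g'(ξ)² + ξ^{3/2} g''(ξ)² ) dξ ≤ C ( ‖Φ‖²_{L²(0,π/2)} + ‖LΦ‖²_{L²(0,π/2)} + ‖HΦ‖²_{L²(0,π/2)} ). -/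
open Real MeasureTheory

/-- `μ(x) = sin³(x)/8`. -/
noncomputable def muFn (x : ℝ) : ℝ := Real.sin x ^ 3 / 8

/-- `ξ(x) = ∫₀^x μ(s) ds`. -/
noncomputable def xiFn (x : ℝ) : ℝ := ∫ s in (0:ℝ)..x, muFn s

/-- `LΦ = μ^{-1/2} (√μ Φ)'`. -/
noncomputable def Lop (Φ : ℝ → ℝ) (x : ℝ) : ℝ :=
  (Real.sqrt (muFn x))⁻¹ * deriv (fun y => Real.sqrt (muFn y) * Φ y) x

/-- `HΦ = −√μ (μ⁻¹ (√μ Φ)')'`. -/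
noncomputable def Hop (Φ : ℝ → ℝ) (x : ℝ) : ℝ :=
  -Real.sqrt (muFn x) *
    deriv (fun y => (muFn y)⁻¹ * deriv (fun w => Real.sqrt (muFn w) * Φ w) y) x

lemma aux_mu_pos {x : ℝ} (hx : x ∈ Set.Ioo (0:ℝ) (Real.pi / 2)) : 0 < muFn x := by
  have : 0 < Real.sin x := Real.sin_pos_of_pos_of_lt_pi hx.1 (by linarith [hx.2, Real.pi_pos])
  unfold muFn; positivity

lemma aux_mu_contDiff : ContDiff ℝ (⊤ : ℕ∞) muFn := by
  unfold muFn
  exact ((Real.contDiff_sin).pow 3).div_const 8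

lemma aux_xi_eq (x : ℝ) : xiFn x = (1 - Real.cos x) ^ 2 * (2 + Real.cos x) / 24 := by
  unfold xiFn muFn
  rw [intervalIntegral.integral_div, integral_sin_pow_three]
  simp only [Real.cos_zero]
  ring

lemma aux_xi_hasStrictDerivAt (x : ℝ) : HasStrictDerivAt xiFn (muFn x) x := by
  have hc : Continuous muFn := aux_mu_contDiff.continuous
  have hd : ∀ y, HasDerivAt xiFn (muFn y) y := fun y =>
    intervalIntegral.integral_hasDerivAt_right (hc.intervalIntegrable _ _)
      hc.aestronglyMeasurable.stronglyMeasurableAtFilter hc.continuousAt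
  exact hasStrictDerivAt_of_hasDerivAt_of_continuousAt (Filter.Eventually.of_forall hd)
    hc.continuousAt

lemma aux_strictMono : StrictMonoOn xiFn (Set.Icc 0 (Real.pi / 2)) := by
  apply strictMonoOn_of_deriv_pos (convex_Icc _ _)
  · exact fun x _ => (aux_xi_hasStrictDerivAt x).hasDerivAt.continuousAt.continuousWithinAt
  · intro x hx
    rw [interior_Icc] at hx
    rw [(aux_xi_hasStrictDerivAt x).hasDerivAt.deriv]
    exact aux_mu_pos hx

lemma aux_image : xiFn '' (Set.Ioo 0 (Real.pi / 2)) = Set.Ioo 0 (xiFn (Real.pi / 2)) := by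
  have h0 : xiFn 0 = 0 := by simp [xiFn]
  have hp : (0:ℝ) ≤ Real.pi / 2 := by positivity
  apply Set.Subset.antisymm
  · rintro _ ⟨x, hx, rfl⟩
    constructor
    · rw [← h0]
      exact aux_strictMono ⟨le_rfl, hp⟩ ⟨hx.1.le, hx.2.le⟩ hx.1
    · exact aux_strictMono ⟨hx.1.le, hx.2.le⟩ ⟨hp, le_rfl⟩ hx.2
  · have := intermediate_value_Ioo hp (f := xiFn)
      (fun x _ => (aux_xi_hasStrictDerivAt x).hasDerivAt.continuousAt.continuousWithinAt)
    rwa [h0] at this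

lemma aux_bounds {x : ℝ} (hx : x ∈ Set.Ioo (0:ℝ) (Real.pi / 2)) :
    0 < xiFn x ∧ xiFn x ^ ((3:ℝ)/2) ≤ 64 * muFn x ^ 2 ∧
      muFn x ^ 2 ≤ 8 * xiFn x ^ ((3:ℝ)/2) := by
  have hs : 0 < Real.sin x := Real.sin_pos_of_pos_of_lt_pi hx.1 (by linarith [hx.2, Real.pi_pos])
  have hc : 0 < Real.cos x := Real.cos_pos_of_mem_Ioo ⟨by linarith [hx.1, Real.pi_pos], hx.2⟩
  have hc1 : Real.cos x ≤ 1 := Real.cos_le_one x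
  have h4 : Real.sin x ^ 4 = (1 - Real.cos x) ^ 2 * (1 + Real.cos x) ^ 2 := by
    have : Real.sin x ^ 2 = 1 - Real.cos x ^ 2 := Real.sin_sq x
    calc Real.sin x ^ 4 = (Real.sin x ^ 2) ^ 2 := by ring
      _ = _ := by rw [this]; ring
  have hlo : Real.sin x ^ 4 / 64 ≤ xiFn x := by
    rw [aux_xi_eq, h4]
    have : (1 + Real.cos x) ^ 2 / 64 ≤ (2 + Real.cos x) / 24 := by nlinarith
    nlinarith [mul_le_mul_of_nonneg_left this (sq_nonneg (1 - Real.cos x))]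
  have hhi : xiFn x ≤ Real.sin x ^ 4 := by
    rw [aux_xi_eq, h4]
    have : (2 + Real.cos x) / 24 ≤ (1 + Real.cos x) ^ 2 := by nlinarith
    nlinarith [mul_le_mul_of_nonneg_left this (sq_nonneg (1 - Real.cos x))]
  have hpos : 0 < xiFn x := lt_of_lt_of_le (by positivity) hlo
  have key : ∀ a : ℝ, 0 ≤ a → (a ^ 2) ^ ((3:ℝ)/2) = a ^ 3 := by
    intro a ha
    rw [← Real.rpow_natCast a 2, ← Real.rpow_mul ha, ← Real.rpow_natCast a 3]
    norm_num
  refine ⟨hpos, ?_, ?_⟩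
  · calc xiFn x ^ ((3:ℝ)/2) ≤ ((Real.sin x ^ 2) ^ 2) ^ ((3:ℝ)/2) :=
          Real.rpow_le_rpow hpos.le (by linarith [hhi]) (by norm_num)
      _ = 64 * muFn x ^ 2 := by rw [key _ (by positivity)]; unfold muFn; ring
  · have : ((Real.sin x ^ 2 / 8) ^ 2) ^ ((3:ℝ)/2) ≤ xiFn x ^ ((3:ℝ)/2) :=
      Real.rpow_le_rpow (by positivity) (by linarith [hlo]) (by norm_num)
    rw [key _ (by positivity)] at this
    unfold muFn
    nlinarith [this]

lemma aux_deriv {G g : ℝ → ℝ} (hG : Differentiable ℝ G)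
    (h : ∀ x ∈ Set.Ioo (0:ℝ) (Real.pi / 2), g (xiFn x) = G x)
    {x : ℝ} (hx : x ∈ Set.Ioo (0:ℝ) (Real.pi / 2)) :
    deriv g (xiFn x) = (muFn x)⁻¹ * deriv G x := by
  have hne : muFn x ≠ 0 := (aux_mu_pos hx).ne'
  have hs := aux_xi_hasStrictDerivAt x
  have hinv := (hs.to_localInverse hne).hasDerivAt
  set inv := hs.localInverse xiFn (muFn x) x hne with hdef
  have hr : ∀ᶠ t in nhds (xiFn x), xiFn (inv t) = t :=
    (hs.hasStrictFDerivAt_equiv hne).eventually_right_inverse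
  have hx0 : inv (xiFn x) = x := (hs.hasStrictFDerivAt_equiv hne).localInverse_apply_image
  have hmem : ∀ᶠ t in nhds (xiFn x), inv t ∈ Set.Ioo (0:ℝ) (Real.pi / 2) := by
    apply hinv.continuousAt.eventually_mem
    rw [hx0]
    exact isOpen_Ioo.mem_nhds hx
  have heq : g =ᶠ[nhds (xiFn x)] G ∘ inv := by
    filter_upwards [hr, hmem] with t h1 h2
    rw [Function.comp_apply, ← h _ h2, h1]
  rw [heq.deriv_eq]
  have hG' : HasDerivAt G (deriv G x) (inv (xiFn x)) := by
    rw [hx0]; exact (hG x).hasDerivAt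
  rw [(hG'.comp _ hinv).deriv, mul_comm]

lemma aux_mul {w f : ℝ → ℝ}
    (hw : ∀ x ∈ Set.Ioo (0:ℝ) (Real.pi / 2), ContDiffAt ℝ (⊤ : ℕ∞) w x)
    (hf : ContDiff ℝ (⊤ : ℕ∞) f) (hs : tsupport f ⊆ Set.Ioo 0 (Real.pi / 2)) :
    ContDiff ℝ (⊤ : ℕ∞) (fun x => w x * f x) ∧
      tsupport (fun x => w x * f x) ⊆ Set.Ioo 0 (Real.pi / 2) := by
  have h : tsupport (fun x => w x * f x) ⊆ Set.Ioo 0 (Real.pi / 2) :=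
    (tsupport_mul_subset_right (f := w) (g := f)).trans hs
  refine ⟨contDiff_iff_contDiffAt.2 fun x => ?_, h⟩
  by_cases hx : x ∈ tsupport (fun x => w x * f x)
  · exact (hw x (h hx)).mul hf.contDiffAt
  · exact (contDiffAt_const (c := (0:ℝ))).congr_of_eventuallyEq
      (notMem_tsupport_iff_eventuallyEq.1 hx)

theorem weighted_graph_norm_estimate :
    ∃ C > (0:ℝ), ∀ Φ g : ℝ → ℝ,
      ContDiff ℝ (⊤ : ℕ∞) Φ → HasCompactSupport Φ → tsupport Φ ⊆ Set.Ioo 0 (Real.pi / 2) →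
      (∀ x ∈ Set.Ioo (0:ℝ) (Real.pi / 2), g (xiFn x) = Real.sqrt (muFn x) * Φ x) →
      (∫ t in (0:ℝ)..(xiFn (Real.pi / 2)),
          (t ^ (-(3:ℝ)/2) * (g t) ^ 2 + (deriv g t) ^ 2
            + t ^ ((3:ℝ)/2) * (deriv (deriv g) t) ^ 2))
        ≤ C * ((∫ x in (0:ℝ)..(Real.pi / 2), (Φ x) ^ 2)
            + (∫ x in (0:ℝ)..(Real.pi / 2), (Lop Φ x) ^ 2)
            + (∫ x in (0:ℝ)..(Real.pi / 2), (Hop Φ x) ^ 2)) := by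
  refine ⟨64, by norm_num, ?_⟩
  intro Φ g hΦ _ hsupp hg
  have hp : (0:ℝ) ≤ Real.pi / 2 := by positivity
  have hsq : ∀ x ∈ Set.Ioo (0:ℝ) (Real.pi / 2),
      ContDiffAt ℝ (⊤ : ℕ∞) (fun y => Real.sqrt (muFn y)) x := fun x hx =>
    aux_mu_contDiff.contDiffAt.sqrt (aux_mu_pos hx).ne'
  obtain ⟨hG, hGs⟩ := aux_mul hsq hΦ hsupp
  have hdiff : ∀ f : ℝ → ℝ, ContDiff ℝ (⊤ : ℕ∞) f → ContDiff ℝ (⊤ : ℕ∞) (deriv f) := by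
    intro f hf
    exact (contDiff_infty_iff_deriv.1 hf).2
  have hts : ∀ f : ℝ → ℝ, tsupport (deriv f) ⊆ tsupport f := fun f =>
    closure_minimal support_deriv_subset (isClosed_tsupport f)
  obtain ⟨hK, hKs⟩ := aux_mul (w := fun y => (muFn y)⁻¹)
    (fun x hx => aux_mu_contDiff.contDiffAt.inv (aux_mu_pos hx).ne')
    (hdiff _ hG) ((hts _).trans hGs)
  have hL : ContDiff ℝ (⊤ : ℕ∞) (Lop Φ) := (aux_mul (w := fun y => (Real.sqrt (muFn y))⁻¹)
    (fun x hx => (hsq x hx).inv (Real.sqrt_pos.2 (aux_mu_pos hx)).ne')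
    (hdiff _ hG) ((hts _).trans hGs)).1
  have hH : ContDiff ℝ (⊤ : ℕ∞) (Hop Φ) := (aux_mul (w := fun y => -Real.sqrt (muFn y))
    (fun x hx => (hsq x hx).neg) (hdiff _ hK) ((hts _).trans hKs)).1
  have hd1 := fun x hx => aux_deriv (hG.differentiable (by simp)) hg (x := x) hx
  have hd2 := fun x hx => aux_deriv (hK.differentiable (by simp)) hd1 (x := x) hx
  have hxi0 : (0:ℝ) ≤ xiFn (Real.pi / 2) := by
    rw [aux_xi_eq, Real.cos_pi_div_two]; norm_num
  have hi1 : IntervalIntegrable (fun x => Φ x ^ 2) volume 0 (Real.pi / 2) :=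
    (hΦ.continuous.pow 2).intervalIntegrable (μ := volume) 0 (Real.pi / 2)
  have hi2 : IntervalIntegrable (fun x => Lop Φ x ^ 2) volume 0 (Real.pi / 2) :=
    (hL.continuous.pow 2).intervalIntegrable (μ := volume) 0 (Real.pi / 2)
  have hi3 : IntervalIntegrable (fun x => Hop Φ x ^ 2) volume 0 (Real.pi / 2) :=
    (hH.continuous.pow 2).intervalIntegrable (μ := volume) 0 (Real.pi / 2)
  have hi : IntervalIntegrable (fun x => 64 * (Φ x ^ 2 + Lop Φ x ^ 2 + Hop Φ x ^ 2)) volume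
      0 (Real.pi / 2) := ((hi1.add hi2).add hi3).const_mul 64
  have hR : 64 * ((∫ x in (0:ℝ)..(Real.pi / 2), (Φ x) ^ 2)
            + (∫ x in (0:ℝ)..(Real.pi / 2), (Lop Φ x) ^ 2)
            + (∫ x in (0:ℝ)..(Real.pi / 2), (Hop Φ x) ^ 2)) =
      ∫ x in Set.Ioo (0:ℝ) (Real.pi / 2), 64 * (Φ x ^ 2 + Lop Φ x ^ 2 + Hop Φ x ^ 2) := by
    rw [← integral_Ioc_eq_integral_Ioo, ← intervalIntegral.integral_of_le hp,
      intervalIntegral.integral_const_mul, intervalIntegral.integral_add (hi1.add hi2) hi3,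
      intervalIntegral.integral_add hi1 hi2]
  rw [hR, intervalIntegral.integral_of_le hxi0, integral_Ioc_eq_integral_Ioo, ← aux_image,
    integral_image_eq_integral_abs_deriv_smul measurableSet_Ioo
      (fun x _ => (aux_xi_hasStrictDerivAt x).hasDerivAt.hasDerivWithinAt)
      (aux_strictMono.injOn.mono Set.Ioo_subset_Icc_self)]
  apply integral_mono_of_nonneg
  · filter_upwards [ae_restrict_mem measurableSet_Ioo] with x hx
    have := (aux_bounds hx).1
    simp only [Pi.zero_apply, smul_eq_mul]
    positivity
  · exact (intervalIntegrable_iff_integrableOn_Ioo_of_le hp).1 hi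
  · filter_upwards [ae_restrict_mem measurableSet_Ioo] with x hx
    obtain ⟨h0, h1, h2⟩ := aux_bounds hx
    have hm := aux_mu_pos hx
    simp only [smul_eq_mul]
    rw [abs_of_pos hm, hd2 x hx, hd1 x hx, hg x hx]
    have hr : xiFn x ^ (-(3:ℝ)/2) = (xiFn x ^ ((3:ℝ)/2))⁻¹ := by
      rw [← Real.rpow_neg h0.le]; norm_num
    rw [hr]
    unfold Lop Hop
    set r := xiFn x ^ ((3:ℝ)/2) with hrdef
    have hrpos : 0 < r := by positivity
    generalize deriv (fun y => (muFn y)⁻¹ * deriv (fun w => Real.sqrt (muFn w) * Φ w) y) x = B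
    generalize deriv (fun w => Real.sqrt (muFn w) * Φ w) x = A
    have hss : Real.sqrt (muFn x) ^ 2 = muFn x := Real.sq_sqrt hm.le
    simp only [mul_pow, inv_pow, neg_sq, hss]
    generalize muFn x = m at *
    have e : m * (r⁻¹ * (m * Φ x ^ 2) + (m ^ 2)⁻¹ * A ^ 2 + r * ((m ^ 2)⁻¹ * B ^ 2))
        = (m ^ 2 / r) * Φ x ^ 2 + m⁻¹ * A ^ 2 + (r / m ^ 2) * (m * B ^ 2) := by
      field_simp
    rw [e]
    have k1 : m ^ 2 / r ≤ 64 := by rw [div_le_iff₀ hrpos]; linarith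
    have k2 : r / m ^ 2 ≤ 64 := by rw [div_le_iff₀ (by positivity)]; linarith
    have k3 := mul_le_mul_of_nonneg_right k1 (sq_nonneg (Φ x))
    have k4 := mul_le_mul_of_nonneg_right k2 (show 0 ≤ m * B ^ 2 by positivity)
    have k5 : 0 ≤ m⁻¹ * A ^ 2 := by positivity
    linarith
end
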